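/- arXiv:1907.01156 — 2 statements merged into one kernel-verified Lean document; each statement's English description precedes it below -/
import Mathlib

section
/- Let M be a unital right A ⊗_tw A'-module and n ≥ 1. On the k-vector space M ⊗ A'^{⊗n}, define: a right A'-action acting on the last tensor factor, (μ ⊗ a'₁ ⊗ … ⊗ a'_n)∗a' = μ ⊗ a'₁ ⊗ … ⊗ (a'_n·a'); and a right A-action (μ ⊗ a'₁ ⊗ … ⊗ a'_n)·a = (μ·(a ⊗ 1)) ⊗ φ^{−g}(a'₁) ⊗ … ⊗ φ^{−g}(a'_n) for homogeneous a ∈ A^g. Then: (i) these two actions satisfy the twisted compatibility (ξ·a)∗a' = (ξ∗φ^{g}(a'))·a for homogeneous a ∈ A^g, hence determine a unital right A ⊗_tw A'-module structure on M ⊗ A'^{⊗n}; (ii) the bar differentials d(μ ⊗ a'₁ ⊗ … ⊗ a'_n) = μ·(1 ⊗ a'₁) ⊗ a'₂ ⊗ … ⊗ a'_n + Σ_{i=1}^{n−1} (−1)^i μ ⊗ a'₁ ⊗ … ⊗ (a'ᵢa'ᵢ₊₁) ⊗ … ⊗ a'_n and the augmentation ε(μ ⊗ a') = μ·(1 ⊗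 a') are homomorphisms of right A ⊗_tw A'-modules; (iii) the augmented complex ⋯ → M ⊗ A' ⊗ A' → M ⊗ A' → M → 0 is exact. (This is the second, A'-direction stage of the twisted bar resolution in the proof of Lemma 3.6 of the paper.) -/
open scoped TensorProduct

/-- The iterated tensor product `M ⊗ A'^{⊗n}`, associated from the left. -/
noncomputable def TwistedBarA' (k : Type) [Field k] (M : Type) [AddCommGroup M] [Module k M]
    (A' : Type) [Ring A'] [Algebra k A'] : ℕ → ModuleCat k
  | 0 => ModuleCat.of k M
  | n + 1 => ModuleCat.of k (TensorProduct k (TwistedBarA' k M A' n) A')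

/-- The pure tensor `ξ ⊗ a'`, regarded as an element of `M ⊗ A'^{⊗(n+1)}`. -/
noncomputable def TwistedBarA'.tmul {k : Type} [Field k] {M : Type} [AddCommGroup M] [Module k M]
    {A' : Type} [Ring A'] [Algebra k A'] {n : ℕ} (ξ : ↥(TwistedBarA' k M A' n)) (a' : A') :
    ↥(TwistedBarA' k M A' (n + 1)) :=
  ξ ⊗ₜ[k] a'

theorem TwistedBarA'.zero_tmul {k : Type} [Field k] {M : Type} [AddCommGroup M] [Module k M]
    {A' : Type} [Ring A'] [Algebra k A'] {n : ℕ} (a' : A') :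
    TwistedBarA'.tmul (0 : ↥(TwistedBarA' k M A' n)) a' = 0 :=
  TensorProduct.zero_tmul _ a'

/-- Induction on `M ⊗ A'^{⊗(n+1)}` along its last tensor factor. -/
theorem TwistedBarA'.induction_last {k : Type} [Field k] {M : Type} [AddCommGroup M] [Module k M]
    {A' : Type} [Ring A'] [Algebra k A'] {n : ℕ} {p : ↥(TwistedBarA' k M A' (n + 1)) → Prop}
    (ξ : ↥(TwistedBarA' k M A' (n + 1))) (zero : p 0)
    (tmul : ∀ (η : ↥(TwistedBarA' k M A' n)) (a' : A'), p (TwistedBarA'.tmul η a'))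
    (add : ∀ ξ η, p ξ → p η → p (ξ + η)) : p ξ :=
  TensorProduct.induction_on (motive := p) ξ zero tmul add

/-- Two linear maps out of a graded algebra agree if they agree on homogeneous elements. -/
theorem LinearMap.eq_of_eq_on_homogeneous {k A X : Type} [Field k] [Ring A] [Algebra k A]
    (𝒜 : ℤ → Submodule k A) [GradedAlgebra 𝒜] [AddCommGroup X] [Module k X] {f g : A →ₗ[k] X}
    (h : ∀ (i : ℤ) (a : A), a ∈ 𝒜 i → f a = g a) (a : A) : f a = g a := by
  induction a using DirectSum.Decomposition.inductionOn 𝒜 with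
  | zero => simp
  | homogeneous a => exact h _ _ a.2
  | add a b ha hb => rw [map_add, map_add, ha, hb]

/-- The second (A'-direction) stage of the twisted bar resolution of a right
module `M` over the twisted tensor product `A ⊗_tw A'`.  Here `TwistedBarA' k M A' n` is
`M ⊗ A'^{⊗n}`, `actA' n` is the right `A'`-action on the last tensor factor of
`M ⊗ A'^{⊗(n+1)}`, `actA n` is the twisted right `A`-action on `M ⊗ A'^{⊗n}` (characterized
recursively, which on pure tensors and homogeneous `a ∈ A^g` gives
`(μ ⊗ a'₁ ⊗ ⋯ ⊗ a'_n) · a = (μ · (a ⊗ 1)) ⊗ φ^{−g} a'₁ ⊗ ⋯ ⊗ φ^{−g} a'_n`), and `D n` is the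
bar differential `M ⊗ A'^{⊗(n+2)} → M ⊗ A'^{⊗(n+1)}` (with `D 0 = ε` the augmentation).
Conclusions: (i) the twisted compatibility of the two actions and the induced unital right
`A ⊗_tw A'`-module structure; (ii) the bar differentials and the augmentation are homomorphisms
of right `A ⊗_tw A'`-modules; (iii) the augmented complex is exact. -/
theorem twisted_bar_resolution_A'_direction
    {k : Type} [Field k]
    {A : Type} [Ring A] [Algebra k A]
    (𝒜 : ℤ → Submodule k A) [GradedAlgebra 𝒜]
    {A' : Type} [Ring A'] [Algebra k A'] (φ : A' ≃ₐ[k] A')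
    (mul : (A ⊗[k] A') →ₗ[k] (A ⊗[k] A') →ₗ[k] (A ⊗[k] A'))
    (hmul : ∀ (a₁ : A) (a₁' a₂' : A') (g : ℤ) (a₂ : A), a₂ ∈ 𝒜 g →
      mul (a₁ ⊗ₜ[k] a₁') (a₂ ⊗ₜ[k] a₂') =
        (a₁ * a₂) ⊗ₜ[k] ((φ ^ (-g)) a₁' * a₂'))
    {M : Type} [AddCommGroup M] [Module k M]
    (τ : M →ₗ[k] (A ⊗[k] A') →ₗ[k] M)
    (hτone : ∀ m : M, τ m ((1 : A) ⊗ₜ[k] (1 : A')) = m)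
    (hτmul : ∀ (m : M) (x y : A ⊗[k] A'), τ (τ m x) y = τ m (mul x y))
    -- the right `A'`-action on the last tensor factor of `M ⊗ A'^{⊗(n+1)}`
    (actA' : ∀ n : ℕ, ↥(TwistedBarA' k M A' (n + 1)) →ₗ[k] A' →ₗ[k] ↥(TwistedBarA' k M A' (n + 1)))
    (hactA' : ∀ (n : ℕ) (ξ : ↥(TwistedBarA' k M A' n)) (a' b' : A'),
      actA' n (ξ ⊗ₜ[k] a') b' = ξ ⊗ₜ[k] (a' * b'))
    -- the twisted right `A`-action on `M ⊗ A'^{⊗n}`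
    (actA : ∀ n : ℕ, ↥(TwistedBarA' k M A' n) →ₗ[k] A →ₗ[k] ↥(TwistedBarA' k M A' n))
    (hactAzero : ∀ (μ : M) (a : A), actA 0 μ a = τ μ (a ⊗ₜ[k] (1 : A')))
    (hactAsucc : ∀ (n : ℕ) (ξ : ↥(TwistedBarA' k M A' n)) (g : ℤ) (a : A), a ∈ 𝒜 g →
      ∀ a' : A', actA (n + 1) (ξ ⊗ₜ[k] a') a = (actA n ξ a) ⊗ₜ[k] ((φ ^ (-g)) a'))
    -- the bar differentials, `D 0 = ε` being the augmentation `ε (μ ⊗ a') = μ · (1 ⊗ a')`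
    (D : ∀ n : ℕ, ↥(TwistedBarA' k M A' (n + 1)) →ₗ[k] ↥(TwistedBarA' k M A' n))
    (hDzero : ∀ (μ : M) (a' : A'), D 0 (μ ⊗ₜ[k] a') = τ μ ((1 : A) ⊗ₜ[k] a'))
    (hDsucc : ∀ (n : ℕ) (ξ : ↥(TwistedBarA' k M A' (n + 1))) (a' : A'),
      D (n + 1) (ξ ⊗ₜ[k] a') =
        HAdd.hAdd (α := ↥(TwistedBarA' k M A' (n + 1))) ((D n ξ) ⊗ₜ[k] a')
          (((-1 : ℤ) ^ (n + 1)) • (actA' n ξ a'))) :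
    -- (i) twisted compatibility of the two actions
    (∀ (n : ℕ) (ξ : ↥(TwistedBarA' k M A' (n + 1))) (g : ℤ) (a : A), a ∈ 𝒜 g → ∀ a' : A',
        actA' n (actA (n + 1) ξ a) a' = actA (n + 1) (actA' n ξ ((φ ^ g) a')) a) ∧
    -- (i) hence a unique unital right `A ⊗_tw A'`-module structure with `ξ·(a⊗a') = (ξ·a)∗a'`
    (∀ n : ℕ, ∃! T : ↥(TwistedBarA' k M A' (n + 1)) →ₗ[k]
        (A ⊗[k] A') →ₗ[k] ↥(TwistedBarA' k M A' (n + 1)),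
      (∀ ξ, T ξ ((1 : A) ⊗ₜ[k] (1 : A')) = ξ) ∧
      (∀ ξ x y, T (T ξ x) y = T ξ (mul x y)) ∧
      (∀ (ξ : ↥(TwistedBarA' k M A' (n + 1))) (a : A) (a' : A'),
        T ξ (a ⊗ₜ[k] a') = actA' n (actA (n + 1) ξ a) a')) ∧
    -- (ii) the bar differentials are homomorphisms of right `A ⊗_tw A'`-modules
    (∀ (n : ℕ)
        (T : ↥(TwistedBarA' k M A' (n + 2)) →ₗ[k] (A ⊗[k] A') →ₗ[k] ↥(TwistedBarA' k M A' (n + 2)))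
        (T' : ↥(TwistedBarA' k M A' (n + 1)) →ₗ[k] (A ⊗[k] A') →ₗ[k] ↥(TwistedBarA' k M A' (n + 1))),
      (∀ (ξ : ↥(TwistedBarA' k M A' (n + 2))) (a : A) (a' : A'),
        T ξ (a ⊗ₜ[k] a') = actA' (n + 1) (actA (n + 2) ξ a) a') →
      (∀ (ξ : ↥(TwistedBarA' k M A' (n + 1))) (a : A) (a' : A'),
        T' ξ (a ⊗ₜ[k] a') = actA' n (actA (n + 1) ξ a) a') →
      ∀ (ξ : ↥(TwistedBarA' k M A' (n + 2))) (x : A ⊗[k] A'),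
        D (n + 1) (T ξ x) = T' (D (n + 1) ξ) x) ∧
    -- (ii) the augmentation is a homomorphism of right `A ⊗_tw A'`-modules
    (∀ T : ↥(TwistedBarA' k M A' 1) →ₗ[k] (A ⊗[k] A') →ₗ[k] ↥(TwistedBarA' k M A' 1),
      (∀ (ξ : ↥(TwistedBarA' k M A' 1)) (a : A) (a' : A'),
        T ξ (a ⊗ₜ[k] a') = actA' 0 (actA 1 ξ a) a') →
      ∀ (ξ : ↥(TwistedBarA' k M A' 1)) (x : A ⊗[k] A'),
        D 0 (T ξ x) = τ (D 0 ξ) x) ∧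
    -- (iii) the augmented complex `⋯ → M ⊗ A' ⊗ A' → M ⊗ A' → M → 0` is exact
    Function.Surjective (D 0) ∧
    (∀ n : ℕ, LinearMap.range (D (n + 1)) = LinearMap.ker (D n)) := by
  replace hactA' : ∀ (n : ℕ) (ξ : ↥(TwistedBarA' k M A' n)) (a' b' : A'),
      actA' n (TwistedBarA'.tmul ξ a') b' = TwistedBarA'.tmul ξ (a' * b') := hactA'
  replace hactAsucc : ∀ (n : ℕ) (ξ : ↥(TwistedBarA' k M A' n)) (g : ℤ) (a : A), a ∈ 𝒜 g →
      ∀ a' : A', actA (n + 1) (TwistedBarA'.tmul ξ a') a =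
        TwistedBarA'.tmul (actA n ξ a) ((φ ^ (-g)) a') := hactAsucc
  replace hDsucc : ∀ (n : ℕ) (ξ : ↥(TwistedBarA' k M A' (n + 1))) (a' : A'),
      D (n + 1) (TwistedBarA'.tmul ξ a') =
        TwistedBarA'.tmul (D n ξ) a' + ((-1 : ℤ) ^ (n + 1)) • actA' n ξ a' := hDsucc
  have compat : ∀ (n : ℕ) (ξ : ↥(TwistedBarA' k M A' (n + 1))) (g : ℤ) (a : A), a ∈ 𝒜 g →
      ∀ a' : A', actA' n (actA (n + 1) ξ a) a' = actA (n + 1) (actA' n ξ ((φ ^ g) a')) a := by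
    intro n ξ g a ha a'
    induction ξ using TwistedBarA'.induction_last with
    | zero => simp
    | tmul η b =>
      rw [hactAsucc n η g a ha, hactA', hactA', hactAsucc n η g a ha, map_mul,
        ← AlgEquiv.mul_apply, ← zpow_add, neg_add_cancel, zpow_zero, AlgEquiv.one_apply]
    | add ξ η hξ hη => simp only [map_add, LinearMap.add_apply, hξ, hη]
  have actA'_one : ∀ (n : ℕ) (ξ : ↥(TwistedBarA' k M A' (n + 1))), actA' n ξ 1 = ξ := by
    intro n ξ
    induction ξ using TwistedBarA'.induction_last with
    | zero => simp
    | tmul η b => rw [hactA', mul_one]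
    | add ξ η hξ hη => simp only [map_add, LinearMap.add_apply, hξ, hη]
  have actA'_mul : ∀ (n : ℕ) (ξ : ↥(TwistedBarA' k M A' (n + 1))) (a' b' : A'),
      actA' n (actA' n ξ a') b' = actA' n ξ (a' * b') := by
    intro n ξ a' b'
    induction ξ using TwistedBarA'.induction_last with
    | zero => simp
    | tmul η b => rw [hactA', hactA', hactA', mul_assoc]
    | add ξ η hξ hη => simp only [map_add, LinearMap.add_apply, hξ, hη]
  have one_mem : (1 : A) ∈ 𝒜 0 := SetLike.GradedOne.one_mem
  have actA_one : ∀ (n : ℕ) (ξ : ↥(TwistedBarA' k M A' n)), actA n ξ 1 = ξ := by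
    intro n
    induction n with
    | zero => intro ξ; exact (hactAzero ξ 1).trans (hτone ξ)
    | succ n ih =>
      intro ξ
      induction ξ using TwistedBarA'.induction_last with
      | zero => simp
      | tmul η b => rw [hactAsucc n η 0 1 one_mem, ih, neg_zero, zpow_zero, AlgEquiv.one_apply]
      | add ξ η hξ hη => simp only [map_add, LinearMap.add_apply, hξ, hη]
  have actA_mul_homogeneous : ∀ (n : ℕ) (ξ : ↥(TwistedBarA' k M A' n)) (g h : ℤ) (a b : A),
      a ∈ 𝒜 g → b ∈ 𝒜 h → actA n (actA n ξ a) b = actA n ξ (a * b) := by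
    intro n
    induction n with
    | zero =>
      intro ξ g h a b ha hb
      refine (hactAzero _ b).trans ?_
      refine (congrArg (fun m : M => τ m (b ⊗ₜ[k] (1 : A'))) (hactAzero ξ a)).trans ?_
      refine Eq.trans ?_ (hactAzero ξ (a * b)).symm
      refine (hτmul ξ _ _).trans ?_
      rw [hmul a 1 1 h b hb, map_one, one_mul]
    | succ n ih =>
      intro ξ g h a b ha hb
      induction ξ using TwistedBarA'.induction_last with
      | zero => simp
      | tmul η c =>
        rw [hactAsucc n η g a ha, hactAsucc n _ h b hb,
          hactAsucc n η (g + h) (a * b) (SetLike.GradedMul.mul_mem ha hb), ih η g h a b ha hb,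
          neg_add_rev, zpow_add, AlgEquiv.mul_apply]
      | add ξ η hξ hη => simp only [map_add, LinearMap.add_apply, hξ, hη]
  have D_actA_homogeneous : ∀ (n : ℕ) (ξ : ↥(TwistedBarA' k M A' (n + 1))) (g : ℤ) (a : A),
      a ∈ 𝒜 g → D n (actA (n + 1) ξ a) = actA n (D n ξ) a := by
    intro n
    induction n with
    | zero =>
      intro ξ g a ha
      induction ξ using TwistedBarA'.induction_last with
      | zero => simp
      | tmul η b =>
        rw [hactAsucc 0 η g a ha]
        refine (hDzero _ _).trans ?_
        refine (congrArg (fun m : M => τ m ((1 : A) ⊗ₜ[k] (φ ^ (-g)) b)) (hactAzero η a)).trans ?_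
        refine Eq.trans ?_ (hactAzero _ a).symm
        refine Eq.trans ?_
          (congrArg (fun m : M => τ m (a ⊗ₜ[k] (1 : A'))) (hDzero η b)).symm
        refine (hτmul η _ _).trans (Eq.trans ?_ (hτmul η _ _).symm)
        rw [hmul a 1 _ 0 1 one_mem, hmul 1 b 1 g a ha, map_one, one_mul, mul_one, mul_one, one_mul]
      | add ξ η hξ hη => simp only [map_add, LinearMap.add_apply, hξ, hη]
    | succ n ih =>
      intro ξ g a ha
      induction ξ using TwistedBarA'.induction_last with
      | zero => simp
      | tmul η b =>
        rw [hactAsucc (n + 1) η g a ha, hDsucc, hDsucc, map_add, LinearMap.add_apply,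
          hactAsucc n _ g a ha, ih η g a ha, map_zsmul, LinearMap.smul_apply, compat n η g a ha,
          ← AlgEquiv.mul_apply, ← zpow_add, add_neg_cancel, zpow_zero, AlgEquiv.one_apply]
      | add ξ η hξ hη => simp only [map_add, LinearMap.add_apply, hξ, hη]
  have D_actA : ∀ (n : ℕ) (ξ : ↥(TwistedBarA' k M A' (n + 1))) (a : A),
      D n (actA (n + 1) ξ a) = actA n (D n ξ) a := fun n ξ =>
    LinearMap.eq_of_eq_on_homogeneous 𝒜 (f := D n ∘ₗ actA (n + 1) ξ) (g := actA n (D n ξ))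
      fun g a ha => D_actA_homogeneous n ξ g a ha
  have D_zero_actA' : ∀ (ξ : ↥(TwistedBarA' k M A' 1)) (a' : A'),
      D 0 (actA' 0 ξ a') = τ (D 0 ξ) ((1 : A) ⊗ₜ[k] a') := by
    intro ξ a'
    induction ξ using TwistedBarA'.induction_last with
    | zero =>
      rw [map_zero, LinearMap.zero_apply, map_zero]
      exact (LinearMap.map_zero₂ τ _).symm
    | tmul η b =>
      rw [hactA']
      refine (hDzero η _).trans ?_
      refine Eq.trans ?_
        (congrArg (fun m : M => τ m ((1 : A) ⊗ₜ[k] a')) (hDzero η b)).symm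
      refine Eq.trans ?_ (hτmul η _ _).symm
      rw [hmul 1 b a' 0 1 one_mem, neg_zero, zpow_zero, AlgEquiv.one_apply, one_mul]
    | add ξ η hξ hη =>
      rw [map_add, LinearMap.add_apply, map_add, hξ, hη, map_add]
      exact (LinearMap.map_add₂ τ _ _ _).symm
  have D_succ_actA' : ∀ (n : ℕ) (ξ : ↥(TwistedBarA' k M A' (n + 2))) (a' : A'),
      D (n + 1) (actA' (n + 1) ξ a') = actA' n (D (n + 1) ξ) a' := by
    intro n ξ a'
    induction ξ using TwistedBarA'.induction_last with
    | zero => simp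
    | tmul η b =>
      rw [hactA', hDsucc, hDsucc, map_add, LinearMap.add_apply, hactA', map_zsmul,
        LinearMap.smul_apply, actA'_mul]
    | add ξ η hξ hη => simp only [map_add, LinearMap.add_apply, hξ, hη]
  have D_comp_D : ∀ (n : ℕ) (ξ : ↥(TwistedBarA' k M A' (n + 2))), D n (D (n + 1) ξ) = 0 := by
    intro n
    induction n with
    | zero =>
      intro ξ
      induction ξ using TwistedBarA'.induction_last with
      | zero => simp
      | tmul η b =>
        rw [hDsucc, pow_succ, pow_zero, one_mul, neg_one_zsmul, map_add, map_neg, D_zero_actA']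
        exact add_neg_eq_zero.mpr (hDzero _ b)
      | add ξ η hξ hη => rw [map_add, map_add, hξ, hη, add_zero]
    | succ n ih =>
      intro ξ
      induction ξ using TwistedBarA'.induction_last with
      | zero => simp
      | tmul η b =>
        rw [hDsucc, map_add, hDsucc, map_zsmul, D_succ_actA', ih η, pow_succ (-1 : ℤ) (n + 1),
          mul_neg_one, neg_smul, add_neg_cancel_right]
        exact TwistedBarA'.zero_tmul b
      | add ξ η hξ hη => rw [map_add, map_add, hξ, hη, add_zero]
  refine ⟨compat, fun n => ?_, fun n T T' hT hT' ξ x => ?_, fun T hT ξ x => ?_, fun m => ?_,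
    fun n => le_antisymm ?_ fun ξ hξ => ?_⟩
  · let T : ↥(TwistedBarA' k M A' (n + 1)) →ₗ[k]
        (A ⊗[k] A') →ₗ[k] ↥(TwistedBarA' k M A' (n + 1)) :=
      (TensorProduct.lift.equiv (RingHom.id k) A A' _).toLinearMap ∘ₗ
        LinearMap.llcomp k A _ _ (actA' n) ∘ₗ actA (n + 1)
    have hT : ∀ (ξ : ↥(TwistedBarA' k M A' (n + 1))) (a : A) (a' : A'),
        T ξ (a ⊗ₜ[k] a') = actA' n (actA (n + 1) ξ a) a' := fun ξ a a' => rfl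
    refine ⟨T, ⟨fun ξ => by rw [hT, actA_one, actA'_one], fun ξ x y => ?_, hT⟩, ?_⟩
    · induction x using TensorProduct.induction_on with
      | zero => simp
      | add x₁ x₂ h₁ h₂ => simp only [map_add, LinearMap.add_apply, h₁, h₂]
      | tmul a a' =>
        induction y using TensorProduct.induction_on with
        | zero => simp
        | add y₁ y₂ h₁ h₂ => simp only [map_add, h₁, h₂]
        | tmul b b' =>
          refine LinearMap.eq_of_eq_on_homogeneous 𝒜
            (f := T (T ξ (a ⊗ₜ[k] a')) ∘ₗ (TensorProduct.mk k A A').flip b')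
            (g := T ξ ∘ₗ mul (a ⊗ₜ[k] a') ∘ₗ (TensorProduct.mk k A A').flip b')
            (fun h b hb => ?_) b
          change T (T ξ (a ⊗ₜ[k] a')) (b ⊗ₜ[k] b') = T ξ (mul (a ⊗ₜ[k] a') (b ⊗ₜ[k] b'))
          have hab : actA (n + 1) (actA (n + 1) ξ a) b = actA (n + 1) ξ (a * b) :=
            LinearMap.eq_of_eq_on_homogeneous 𝒜
              (f := (actA (n + 1)).flip b ∘ₗ actA (n + 1) ξ)
              (g := actA (n + 1) ξ ∘ₗ LinearMap.mulRight k b)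
              (fun g a ha => actA_mul_homogeneous (n + 1) ξ g h a b ha hb) a
          have hcomm := compat n (actA (n + 1) ξ a) h b hb ((φ ^ (-h)) a')
          rw [← AlgEquiv.mul_apply, ← zpow_add, add_neg_cancel, zpow_zero,
            AlgEquiv.one_apply] at hcomm
          rw [hmul a a' b' h b hb, hT, hT, hT, ← hcomm, actA'_mul, hab]
    · rintro S ⟨-, -, hS⟩
      refine LinearMap.ext fun ξ => TensorProduct.ext' fun a a' => ?_
      rw [hS, hT]
  · induction x using TensorProduct.induction_on with
    | zero => simp
    | tmul a a' => rw [hT, hT', D_succ_actA', D_actA]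
    | add x y hx hy => simp only [map_add, hx, hy]
  · induction x using TensorProduct.induction_on with
    | zero =>
      rw [map_zero, map_zero]
      exact (map_zero (τ (D 0 ξ))).symm
    | tmul a a' =>
      rw [hT, D_zero_actA', D_actA]
      refine (congrArg (fun m : M => τ m ((1 : A) ⊗ₜ[k] a')) (hactAzero _ a)).trans ?_
      refine (hτmul _ _ _).trans ?_
      rw [hmul a 1 a' 0 1 one_mem, map_one, one_mul, mul_one]
    | add x y hx hy =>
      rw [map_add, map_add, hx, hy]
      exact (map_add (τ (D 0 ξ)) x y).symm
  · exact ⟨m ⊗ₜ[k] (1 : A'), (hDzero m 1).trans (hτone m)⟩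
  · rintro _ ⟨ξ, rfl⟩
    exact D_comp_D n ξ
  · have hξ' : D n ξ = 0 := hξ
    have key : D (n + 1) (TwistedBarA'.tmul ξ (1 : A')) = ((-1 : ℤ) ^ (n + 1)) • ξ := by
      rw [hDsucc, actA'_one, hξ', TwistedBarA'.zero_tmul, zero_add]
    have hsq : ((-1 : ℤ) ^ (n + 1)) • ((-1 : ℤ) ^ (n + 1)) • ξ = ξ := by
      rw [smul_smul, ← mul_pow, neg_one_mul, neg_neg, one_pow, one_smul]
    rw [← hsq, ← key]
    exact Submodule.smul_of_tower_mem _ _ (LinearMap.mem_range_self _ _)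
end

section
/- Every unital right A ⊗_tw A'-module M admits a bar-type resolution by right A ⊗_tw A'-modules: there is an exact sequence of right A ⊗_tw A'-modules ⋯ → P₂ → P₁ → P₀ → M → 0 in which, for each j ≥ 0, the module P_j is isomorphic as a k-vector space to the direct sum ⊕_{m+n=j, m,n≥0} M ⊗ A^{⊗(m+1)} ⊗ A'^{⊗(n+1)}. (This is Lemma 3.6 of the paper, stated in the case where the cohomological grading of A and A' is concentrated in degree 0, so that twisted graded right-right A–A'-bimodules are right A ⊗_tw A'-modules.) -/
open scoped TensorProduct
open scoped DirectSum

universe u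

/-! ### Exactness of the total complex of a double complex -/

namespace BarDoubleComplex

section

variable {k : Type u} [CommRing k] {E : ℕ → ℕ → Type u} [∀ m n, AddCommGroup (E m n)]
  [∀ m n, Module k (E m n)] (v : ∀ m n, E m (n + 1) →ₗ[k] E m n)
  (h : ∀ m n, E (m + 1) n →ₗ[k] E m n)

/-- The index set of the `j`-th diagonal. -/
abbrev Diagonal (j : ℕ) : Type := {p : ℕ × ℕ // p.1 + p.2 = j}

/-- The total differential of the part of a doubly augmented double complex with positive
indices. -/
def totalD (j : ℕ) :
    (∀ p : Diagonal (j + 1), E (p.1.1 + 1) (p.1.2 + 1)) →ₗ[k]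
      ∀ p : Diagonal j, E (p.1.1 + 1) (p.1.2 + 1) :=
  LinearMap.pi fun p =>
    v (p.1.1 + 1) (p.1.2 + 1) ∘ₗ
        LinearMap.proj (⟨(p.1.1, p.1.2 + 1), by have := p.2; simp only; omega⟩ : Diagonal (j + 1)) +
      (-1 : k) ^ p.1.2 • (h (p.1.1 + 1) (p.1.2 + 1) ∘ₗ
        LinearMap.proj (⟨(p.1.1 + 1, p.1.2), by have := p.2; simp only; omega⟩ : Diagonal (j + 1)))

/-- The total augmentation. -/
def totalε : (∀ p : Diagonal 0, E (p.1.1 + 1) (p.1.2 + 1)) →ₗ[k] E 0 0 :=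
  h 0 0 ∘ₗ v 1 0 ∘ₗ LinearMap.proj (⟨(0, 0), rfl⟩ : Diagonal 0)

lemma totalD_apply (j : ℕ) (x : ∀ p : Diagonal (j + 1), E (p.1.1 + 1) (p.1.2 + 1)) (m n : ℕ)
    (hmn : m + n = j) :
    totalD v h j x ⟨(m, n), hmn⟩ =
      v (m + 1) (n + 1) (x ⟨(m, n + 1), by simp only; omega⟩) +
        (-1 : k) ^ n • h (m + 1) (n + 1) (x ⟨(m + 1, n), by simp only; omega⟩) := rfl

lemma totalD_totalD
    (hvv : ∀ m n x, v m n (v m (n + 1) x) = 0) (hhh : ∀ m n x, h m n (h (m + 1) n x) = 0)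
    (hvh : ∀ m n x, v m n (h m (n + 1) x) = h m n (v (m + 1) n x))
    (j : ℕ) (x : ∀ p : Diagonal (j + 1 + 1), E (p.1.1 + 1) (p.1.2 + 1)) :
    totalD v h j (totalD v h (j + 1) x) = 0 := by
  funext ⟨⟨m, n⟩, hmn⟩
  simp only [totalD_apply, map_add, map_smul, hvv, hhh, hvh, pow_succ]
  simp

lemma totalε_totalD
    (hvv : ∀ m n x, v m n (v m (n + 1) x) = 0) (hhh : ∀ m n x, h m n (h (m + 1) n x) = 0)
    (hvh : ∀ m n x, v m n (h m (n + 1) x) = h m n (v (m + 1) n x))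
    (x : ∀ p : Diagonal 1, E (p.1.1 + 1) (p.1.2 + 1)) :
    totalε v h (totalD v h 0 x) = 0 := by
  change h 0 0 (v 1 0 (totalD v h 0 x ⟨(0, 0), rfl⟩)) = 0
  simp only [totalD_apply, map_add, map_smul, hvv, hhh, hvh]
  simp

lemma exists_totalD_eq
    (s : ∀ m n, E m n →ₗ[k] E m (n + 1))
    (hs : ∀ m n x, v m (n + 1) (s m (n + 1) x) + s m n (v m n x) = x)
    (hsh : ∀ m n x, h m (n + 1) (s (m + 1) n x) = s m n (h m n x))
    (hex : ∀ m x, h m 0 x = 0 → ∃ y, h (m + 1) 0 y = x)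
    (j : ℕ) (x : ∀ p : Diagonal j, E (p.1.1 + 1) (p.1.2 + 1))
    (hx₀ : ∀ m (hm : m + 0 = j), h m 0 (v (m + 1) 0 (x ⟨(m, 0), hm⟩)) = 0)
    (hx : ∀ m n (hmn : m + (n + 1) = j),
      v (m + 1) (n + 1) (x ⟨(m, n + 1), hmn⟩) +
        (-1 : k) ^ n • h (m + 1) (n + 1) (x ⟨(m + 1, n), by simp only; omega⟩) = 0) :
    ∃ w, totalD v h j w = x := by
  choose y hy using fun m hm => hex m _ (hx₀ m hm)
  let w : ∀ p : Diagonal (j + 1), E (p.1.1 + 1) (p.1.2 + 1) := fun p =>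
    match p with
    | ⟨(0, 0), _⟩ => 0
    | ⟨(m + 1, 0), hm⟩ => s (m + 2) 0 (y m (by simp only at hm; omega))
    | ⟨(m, n + 1), hm⟩ => s (m + 1) (n + 1) (x ⟨(m, n), by simp only at hm ⊢; omega⟩)
  have hw₀ (m) (hm) : w ⟨(m + 1, 0), hm⟩ = s (m + 2) 0 (y m (by simp only at hm; omega)) := rfl
  have hw (m n) (hm) : w ⟨(m, n + 1), hm⟩ =
      s (m + 1) (n + 1) (x ⟨(m, n), by simp only at hm ⊢; omega⟩) := by
    cases m <;> rfl
  refine ⟨w, ?_⟩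
  funext ⟨⟨m, n⟩, hmn⟩
  rw [totalD_apply, hw]
  cases n with
  | zero =>
    rw [hw₀ m (by simp only at hmn ⊢; omega), hsh, hy, pow_zero, one_smul, hs]
  | succ n =>
    rw [hw (m + 1) n (by simp only at hmn ⊢; omega), hsh]
    have key := congrArg (s (m + 1) (n + 1)) (hx m n hmn)
    rw [map_add, map_smul, map_zero] at key
    conv_rhs => rw [← hs (m + 1) (n + 1) (x ⟨(m, n + 1), hmn⟩)]
    rw [pow_succ, eq_neg_of_add_eq_zero_left key]
    simp

lemma range_totalD_zero
    (hvv : ∀ m n x, v m n (v m (n + 1) x) = 0) (hhh : ∀ m n x, h m n (h (m + 1) n x) = 0)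
    (hvh : ∀ m n x, v m n (h m (n + 1) x) = h m n (v (m + 1) n x))
    (s : ∀ m n, E m n →ₗ[k] E m (n + 1))
    (hs : ∀ m n x, v m (n + 1) (s m (n + 1) x) + s m n (v m n x) = x)
    (hsh : ∀ m n x, h m (n + 1) (s (m + 1) n x) = s m n (h m n x))
    (hex : ∀ m x, h m 0 x = 0 → ∃ y, h (m + 1) 0 y = x) :
    LinearMap.range (totalD v h 0) = LinearMap.ker (totalε v h) := by
  apply le_antisymm
  · rintro _ ⟨x, rfl⟩
    exact totalε_totalD v h hvv hhh hvh x
  · intro x hx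
    refine exists_totalD_eq v h s hs hsh hex 0 x (fun m hm => ?_) (fun m n hmn => by omega)
    obtain rfl : m = 0 := hm
    exact hx

lemma range_totalD_succ
    (hvv : ∀ m n x, v m n (v m (n + 1) x) = 0) (hhh : ∀ m n x, h m n (h (m + 1) n x) = 0)
    (hvh : ∀ m n x, v m n (h m (n + 1) x) = h m n (v (m + 1) n x))
    (s : ∀ m n, E m n →ₗ[k] E m (n + 1))
    (hs : ∀ m n x, v m (n + 1) (s m (n + 1) x) + s m n (v m n x) = x)
    (hsh : ∀ m n x, h m (n + 1) (s (m + 1) n x) = s m n (h m n x))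
    (hex : ∀ m x, h m 0 x = 0 → ∃ y, h (m + 1) 0 y = x)
    (j : ℕ) :
    LinearMap.range (totalD v h (j + 1)) = LinearMap.ker (totalD v h j) := by
  apply le_antisymm
  · rintro _ ⟨x, rfl⟩
    exact totalD_totalD v h hvv hhh hvh j x
  · intro x hx
    have hx' : ∀ m n (hmn : m + n = j), _ := fun m n hmn =>
      (totalD_apply v h j x m n hmn).symm.trans (congrFun hx ⟨(m, n), hmn⟩)
    refine exists_totalD_eq v h s hs hsh hex (j + 1) x (fun m hm => ?_)
      (fun m n hmn => hx' m n (by omega))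
    obtain rfl : m = j + 1 := hm
    have := congrArg (v (j + 1) 0) (hx' j 0 rfl)
    simpa [hvv, hvh] using this

lemma totalε_surjective
    (s : ∀ m n, E m n →ₗ[k] E m (n + 1)) (hs₀ : ∀ m x, v m 0 (s m 0 x) = x)
    (ht : Function.Surjective (h 0 0)) :
    Function.Surjective (totalε v h) := by
  intro z
  obtain ⟨y, rfl⟩ := ht z
  refine ⟨fun p => match p with
    | ⟨(0, 0), _⟩ => s 1 0 y
    | ⟨(m + 1, n), hm⟩ => 0
    | ⟨(m, n + 1), hm⟩ => 0, ?_⟩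
  exact congrArg (h 0 0) (hs₀ 1 y)

end

end BarDoubleComplex

/-! ### Right modules over a twisted tensor product -/

section

variable {k : Type u} [Field k] {A A' : Type u} [Ring A] [Ring A'] [Algebra k A']
  [Algebra k A]

/-- A right module over the twisted tensor product, presented by its right actions of `A` and of
`A'`. -/
structure TwistedModule (𝒜 : ℤ → Submodule k A) (φ : A' ≃ₐ[k] A') : Type (u + 1) where
  /-- The underlying vector space. -/
  carrier : Type u
  [addCommGroup : AddCommGroup carrier]
  [module : Module k carrier]
  /-- The right action of `A`. -/
  actA : A →ₗ[k] Module.End k carrier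
  /-- The right action of `A'`. -/
  actA' : A' →ₗ[k] Module.End k carrier
  actA_one : ∀ m, actA 1 m = m
  actA_mul : ∀ a b m, actA (a * b) m = actA b (actA a m)
  actA'_one : ∀ m, actA' 1 m = m
  actA'_mul : ∀ a b m, actA' (a * b) m = actA' b (actA' a m)
  actA_actA' : ∀ g, ∀ a ∈ 𝒜 g, ∀ a' m, actA a (actA' a' m) = actA' ((φ ^ (-g)) a') (actA a m)

namespace TwistedModule

attribute [instance] addCommGroup module

variable {𝒜 : ℤ → Submodule k A} {φ : A' ≃ₐ[k] A'}

instance : CoeSort (TwistedModule 𝒜 φ) (Type u) := ⟨carrier⟩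

lemma actA_actA'_zpow (M : TwistedModule 𝒜 φ) (g : ℤ) (a : A) (ha : a ∈ 𝒜 g) (a' : A') (m : M) :
    M.actA a (M.actA' ((φ ^ g) a') m) = M.actA' a' (M.actA a m) := by
  rw [M.actA_actA' g a ha, ← AlgEquiv.mul_apply, ← zpow_add, neg_add_cancel, zpow_zero,
    AlgEquiv.one_apply]

/-- The right action of `A ⊗ A'`. -/
def act (M : TwistedModule 𝒜 φ) : M →ₗ[k] (A ⊗[k] A') →ₗ[k] M :=
  (TensorProduct.lift ((LinearMap.mul k (Module.End k M)).flip.compl₁₂ M.actA M.actA')).flip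

lemma act_tmul (M : TwistedModule 𝒜 φ) (m : M) (a : A) (a' : A') :
    M.act m (a ⊗ₜ a') = M.actA' a' (M.actA a m) := rfl

lemma act_one (M : TwistedModule 𝒜 φ) (m : M) : M.act m ((1 : A) ⊗ₜ (1 : A')) = m := by
  rw [act_tmul, M.actA_one, M.actA'_one]

lemma act_act [GradedAlgebra 𝒜] (M : TwistedModule 𝒜 φ)
    (mul : (A ⊗[k] A') →ₗ[k] (A ⊗[k] A') →ₗ[k] (A ⊗[k] A'))
    (hmul : ∀ (a₁ : A) (a₁' a₂' : A') (g : ℤ) (a₂ : A), a₂ ∈ 𝒜 g →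
      mul (a₁ ⊗ₜ[k] a₁') (a₂ ⊗ₜ[k] a₂') =
        (a₁ * a₂) ⊗ₜ[k] ((φ ^ (-g)) a₁' * a₂'))
    (m : M) (x y : A ⊗[k] A') : M.act (M.act m x) y = M.act m (mul x y) := by
  induction x with
  | zero => simp
  | add x₁ x₂ h₁ h₂ => simp [h₁, h₂]
  | tmul a₁ a₁' =>
    induction y with
    | zero => simp
    | add y₁ y₂ h₁ h₂ => simp [h₁, h₂]
    | tmul a₂ a₂' =>
      induction a₂ using DirectSum.Decomposition.inductionOn 𝒜 with
      | zero => simp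
      | add b c hb hc => simp only [TensorProduct.add_tmul, map_add, hb, hc]
      | @homogeneous g b =>
        rw [hmul a₁ a₁' a₂' g b b.2]
        simp only [act_tmul, M.actA_mul, M.actA'_mul, M.actA_actA' g b b.2]

/-- A linear map commuting with the two right actions. -/
structure IsHom {M N : TwistedModule 𝒜 φ} (f : M →ₗ[k] N) : Prop where
  map_actA : ∀ a m, f (M.actA a m) = N.actA a (f m)
  map_actA' : ∀ a m, f (M.actA' a m) = N.actA' a (f m)

lemma IsHom.map_act {M N : TwistedModule 𝒜 φ} {f : M →ₗ[k] N} (hf : IsHom f) (m : M)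
    (x : A ⊗[k] A') : f (M.act m x) = N.act (f m) x := by
  induction x with
  | zero => simp
  | add x₁ x₂ h₁ h₂ => simp [h₁, h₂]
  | tmul a a' => rw [act_tmul, act_tmul, hf.map_actA', hf.map_actA]

lemma IsHom.sub {M N : TwistedModule 𝒜 φ} {f g : M →ₗ[k] N} (hf : IsHom f) (hg : IsHom g) :
    IsHom (f - g) where
  map_actA a m := by simp [hf.map_actA, hg.map_actA]
  map_actA' a m := by simp [hf.map_actA', hg.map_actA']

lemma IsHom.add {M N : TwistedModule 𝒜 φ} {f g : M →ₗ[k] N} (hf : IsHom f) (hg : IsHom g) :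
    IsHom (f + g) where
  map_actA a m := by simp [hf.map_actA, hg.map_actA]
  map_actA' a m := by simp [hf.map_actA', hg.map_actA']

lemma IsHom.smul {M N : TwistedModule 𝒜 φ} {f : M →ₗ[k] N} (hf : IsHom f) (c : k) :
    IsHom (c • f) where
  map_actA a m := by simp [hf.map_actA]
  map_actA' a m := by simp [hf.map_actA']

lemma IsHom.comp {M N P : TwistedModule 𝒜 φ} {f : N →ₗ[k] P} {g : M →ₗ[k] N} (hf : IsHom f)
    (hg : IsHom g) : IsHom (f ∘ₗ g) where
  map_actA a m := by simp [hf.map_actA, hg.map_actA]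
  map_actA' a m := by simp [hf.map_actA', hg.map_actA']

/-- The product of a family of modules. -/
def pi {ι : Type} (M : ι → TwistedModule 𝒜 φ) : TwistedModule 𝒜 φ where
  carrier := ∀ i, M i
  actA :=
    { toFun := fun a => LinearMap.pi fun i => (M i).actA a ∘ₗ LinearMap.proj i
      map_add' := fun a b => by ext; simp
      map_smul' := fun c a => by ext; simp }
  actA' :=
    { toFun := fun a => LinearMap.pi fun i => (M i).actA' a ∘ₗ LinearMap.proj i
      map_add' := fun a b => by ext; simp
      map_smul' := fun c a => by ext; simp }
  actA_one m := funext fun i => (M i).actA_one (m i)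
  actA_mul a b m := funext fun i => (M i).actA_mul a b (m i)
  actA'_one m := funext fun i => (M i).actA'_one (m i)
  actA'_mul a b m := funext fun i => (M i).actA'_mul a b (m i)
  actA_actA' g a ha a' m := funext fun i => (M i).actA_actA' g a ha a' (m i)

lemma isHom_proj {ι : Type} (M : ι → TwistedModule 𝒜 φ) (i : ι) :
    IsHom (M := pi M) (N := M i) (LinearMap.proj i) where
  map_actA _ _ := rfl
  map_actA' _ _ := rfl

lemma IsHom.pi {ι : Type} {M : ι → TwistedModule 𝒜 φ} {N : TwistedModule 𝒜 φ}
    {f : ∀ i, N →ₗ[k] M i} (hf : ∀ i, IsHom (f i)) :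
    IsHom (M := N) (N := TwistedModule.pi M) (LinearMap.pi f) where
  map_actA a m := funext fun i => (hf i).map_actA a m
  map_actA' a m := funext fun i => (hf i).map_actA' a m

end TwistedModule

/-! ### The bar resolution attached to an augmented endofunctor -/

open TwistedModule

/-- An endofunctor of the category of modules over the twisted tensor product with underlying
vector space `M ⊗ B`, together with an augmentation having a natural linear section. -/
structure AugmentedFunctor (𝒜 : ℤ → Submodule k A) (φ : A' ≃ₐ[k] A') (B : Type u)
    [AddCommGroup B] [Module k B] where
  /-- The action on objects. -/
  obj : TwistedModule 𝒜 φ → TwistedModule 𝒜 φ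
  /-- The action on linear maps. -/
  map : ∀ {M N : TwistedModule 𝒜 φ}, (M →ₗ[k] N) → (obj M →ₗ[k] obj N)
  /-- The augmentation. -/
  ε : ∀ M, obj M →ₗ[k] M
  /-- The linear section of the augmentation. -/
  s : ∀ M : TwistedModule 𝒜 φ, M →ₗ[k] obj M
  /-- The underlying vector space. -/
  equiv : ∀ M : TwistedModule 𝒜 φ, obj M ≃ₗ[k] M ⊗[k] B
  map_sub : ∀ {M N : TwistedModule 𝒜 φ} (f g : M →ₗ[k] N), map (f - g) = map f - map g
  map_comp : ∀ {M N P : TwistedModule 𝒜 φ} (f : M →ₗ[k] N) (g : N →ₗ[k] P),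
    map (g ∘ₗ f) = map g ∘ₗ map f
  isHom_map : ∀ {M N : TwistedModule 𝒜 φ} {f : M →ₗ[k] N}, IsHom f → IsHom (map f)
  isHom_ε : ∀ M, IsHom (ε M)
  ε_map : ∀ {M N : TwistedModule 𝒜 φ} {f : M →ₗ[k] N}, IsHom f → ∀ x, ε N (map f x) = f (ε M x)
  ε_s : ∀ M x, ε M (s M x) = x
  map_s : ∀ {M N : TwistedModule 𝒜 φ} (f : M →ₗ[k] N) x, map f (s M x) = s N (f x)

namespace AugmentedFunctor

variable {𝒜 : ℤ → Submodule k A} {φ : A' ≃ₐ[k] A'} {B : Type u} [AddCommGroup B] [Module k B]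
  (K : AugmentedFunctor 𝒜 φ B)

lemma map_zero {M N : TwistedModule 𝒜 φ} : K.map (0 : M →ₗ[k] N) = 0 := by
  simpa using K.map_sub (0 : M →ₗ[k] N) 0

lemma map_map_of_comp_eq {M N N' P : TwistedModule 𝒜 φ} {f : M →ₗ[k] N} {g : N →ₗ[k] P}
    {f' : M →ₗ[k] N'} {g' : N' →ₗ[k] P} (hfg : ∀ x, g (f x) = g' (f' x)) (x : K.obj M) :
    K.map g (K.map f x) = K.map g' (K.map f' x) := by
  have hcomp : g ∘ₗ f = g' ∘ₗ f' := LinearMap.ext hfg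
  rw [← LinearMap.comp_apply, ← K.map_comp, hcomp, K.map_comp, LinearMap.comp_apply]

/-- The differential of the bar complex following a given one. -/
def next {M : TwistedModule 𝒜 φ} (f : K.obj M →ₗ[k] M) : K.obj (K.obj M) →ₗ[k] K.obj M :=
  K.ε (K.obj M) - K.map f

lemma next_apply {M : TwistedModule 𝒜 φ} (f : K.obj M →ₗ[k] M) (x : K.obj (K.obj M)) :
    K.next f x = K.ε (K.obj M) x - K.map f x := rfl

lemma isHom_next {M : TwistedModule 𝒜 φ} {f : K.obj M →ₗ[k] M} (hf : IsHom f) :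
    IsHom (K.next f) :=
  (K.isHom_ε _).sub (K.isHom_map hf)

lemma ε_next_ε (M : TwistedModule 𝒜 φ) (x : K.obj (K.obj M)) :
    K.ε M (K.next (K.ε M) x) = 0 := by
  rw [next_apply, _root_.map_sub, K.ε_map (K.isHom_ε M), sub_self]

lemma next_next {M : TwistedModule 𝒜 φ} {f : K.obj M →ₗ[k] M} (hf : IsHom f)
    (hff : ∀ x, f (K.next f x) = 0) (x : K.obj (K.obj (K.obj M))) :
    K.next f (K.next (K.next f) x) = 0 := by
  have hzero : K.map f (K.map (K.next f) x) = 0 := by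
    rw [K.map_map_of_comp_eq (f' := (0 : _ →ₗ[k] M)) (g' := (0 : M →ₗ[k] M)) (by simpa using hff),
      K.map_zero, LinearMap.zero_apply]
  rw [K.next_apply (K.next f), _root_.map_sub, ← K.ε_map (K.isHom_next hf),
    K.next_apply f (K.map _ _), hzero, sub_zero, sub_self]

lemma next_map_map {M N : TwistedModule 𝒜 φ} {f : M →ₗ[k] N} (hf : IsHom f)
    {dM : K.obj M →ₗ[k] M} {dN : K.obj N →ₗ[k] N} (hd : ∀ x, dN (K.map f x) = f (dM x))
    (x : K.obj (K.obj M)) : K.next dN (K.map (K.map f) x) = K.map f (K.next dM x) := by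
  rw [next_apply, next_apply, _root_.map_sub, K.ε_map (K.isHom_map hf), K.map_map_of_comp_eq hd]

lemma next_s_add {M : TwistedModule 𝒜 φ} (f : K.obj M →ₗ[k] M) (x : K.obj M) :
    K.next f (K.s _ x) + K.s _ (f x) = x := by
  rw [next_apply, K.ε_s, K.map_s, sub_add_cancel]

/-- The iterates of the functor on objects. -/
def iter (M : TwistedModule 𝒜 φ) : ℕ → TwistedModule 𝒜 φ
  | 0 => M
  | n + 1 => K.obj (iter M n)

/-- The iterates of the functor on linear maps. -/
def mapIter {M N : TwistedModule 𝒜 φ} (f : M →ₗ[k] N) : ∀ n, K.iter M n →ₗ[k] K.iter N n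
  | 0 => f
  | n + 1 => K.map (mapIter f n)

/-- The differential of the augmented bar complex. -/
def d (M : TwistedModule 𝒜 φ) : ∀ n, K.iter M (n + 1) →ₗ[k] K.iter M n
  | 0 => K.ε M
  | n + 1 => K.next (M := K.iter M n) (d M n)

/-- The linear contraction of the augmented bar complex. -/
def contraction (M : TwistedModule 𝒜 φ) (n : ℕ) : K.iter M n →ₗ[k] K.iter M (n + 1) :=
  K.s (K.iter M n)

lemma isHom_mapIter {M N : TwistedModule 𝒜 φ} {f : M →ₗ[k] N} (hf : IsHom f) :
    ∀ n, IsHom (K.mapIter f n)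
  | 0 => hf
  | n + 1 => K.isHom_map (isHom_mapIter hf n)

lemma isHom_d (M : TwistedModule 𝒜 φ) : ∀ n, IsHom (K.d M n)
  | 0 => K.isHom_ε M
  | n + 1 => K.isHom_next (M := K.iter M n) (isHom_d M n)

lemma mapIter_comp {M N P : TwistedModule 𝒜 φ} (f : M →ₗ[k] N) (g : N →ₗ[k] P) :
    ∀ n, K.mapIter (g ∘ₗ f) n = K.mapIter g n ∘ₗ K.mapIter f n
  | 0 => rfl
  | n + 1 => (congrArg K.map (mapIter_comp f g n)).trans (K.map_comp _ _)

lemma mapIter_zero {M N : TwistedModule 𝒜 φ} : ∀ n, K.mapIter (0 : M →ₗ[k] N) n = 0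
  | 0 => rfl
  | n + 1 => (congrArg K.map (mapIter_zero n)).trans K.map_zero

lemma d_d (M : TwistedModule 𝒜 φ) : ∀ n x, K.d M n (K.d M (n + 1) x) = 0
  | 0, x => K.ε_next_ε M x
  | n + 1, x => K.next_next (M := K.iter M n) (K.isHom_d M n) (d_d M n) x

lemma d_mapIter {M N : TwistedModule 𝒜 φ} {f : M →ₗ[k] N} (hf : IsHom f) :
    ∀ n x, K.d N n (K.mapIter f (n + 1) x) = K.mapIter f n (K.d M n x)
  | 0, x => K.ε_map hf x
  | n + 1, x => K.next_map_map (M := K.iter M n) (N := K.iter N n) (K.isHom_mapIter hf n)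
      (d_mapIter hf n) x

lemma d_zero_contraction (M : TwistedModule 𝒜 φ) (x : K.iter M 0) :
    K.d M 0 (K.contraction M 0 x) = x :=
  K.ε_s M x

lemma d_contraction_add (M : TwistedModule 𝒜 φ) (n : ℕ) (x : K.iter M (n + 1)) :
    K.d M (n + 1) (K.contraction M (n + 1) x) + K.contraction M n (K.d M n x) = x :=
  K.next_s_add (M := K.iter M n) (K.d M n) x

lemma mapIter_contraction {M N : TwistedModule 𝒜 φ} (f : M →ₗ[k] N) (n : ℕ) (x : K.iter M n) :
    K.mapIter f (n + 1) (K.contraction M n x) = K.contraction N n (K.mapIter f n x) :=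
  K.map_s _ x

/-- The underlying vector space of an iterate. -/
noncomputable def iterEquiv (M : TwistedModule 𝒜 φ) :
    ∀ n, K.iter M n ≃ₗ[k] M ⊗[k] TensorPower k n B
  | 0 => (TensorProduct.rid k M).symm ≪≫ₗ
      TensorProduct.congr (LinearEquiv.refl k M) (PiTensorProduct.isEmptyEquiv (Fin 0)).symm
  | n + 1 => K.equiv (K.iter M n) ≪≫ₗ
      TensorProduct.congr (iterEquiv M n)
        (PiTensorProduct.subsingletonEquiv (R := k) (s := fun _ : Fin 1 => B) 0).symm ≪≫ₗ
      TensorProduct.assoc k M (TensorPower k n B) (TensorPower k 1 B) ≪≫ₗ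
      TensorProduct.congr (LinearEquiv.refl k M) TensorPower.mulEquiv

end AugmentedFunctor

/-! ### The two induction functors -/

section Induction

variable (𝒜 : ℤ → Submodule k A) {φ : A' ≃ₐ[k] A'} [GradedAlgebra 𝒜]

/-- The linear map given by prescribed linear maps on the homogeneous components. -/
noncomputable def gradedLift {X : Type u} [AddCommMonoid X] [Module k X] (f : ℤ → (A →ₗ[k] X)) :
    A →ₗ[k] X :=
  DirectSum.toModule k ℤ X (fun g => f g ∘ₗ (𝒜 g).subtype) ∘ₗ
    (DirectSum.decomposeLinearEquiv 𝒜).toLinearMap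

lemma gradedLift_of_mem {X : Type u} [AddCommMonoid X] [Module k X] (f : ℤ → (A →ₗ[k] X))
    {g : ℤ} {a : A} (ha : a ∈ 𝒜 g) : gradedLift 𝒜 f a = f g a := by
  lift a to 𝒜 g using ha
  simp [gradedLift]

variable {𝒜}

/-- The action of `A` on the module induced along `A ⊆ A ⊗_tw A'`. -/
noncomputable def inducedActA (M : TwistedModule 𝒜 φ) : A →ₗ[k] Module.End k (M ⊗[k] A') :=
  gradedLift 𝒜 fun g =>
    (TensorProduct.mapBilinear (RingHom.id k) M A' M A').flip (φ ^ (-g)).toLinearMap ∘ₗ M.actA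

lemma inducedActA_tmul (M : TwistedModule 𝒜 φ) {g : ℤ} {a : A} (ha : a ∈ 𝒜 g) (m : M) (a' : A') :
    inducedActA M a (m ⊗ₜ a') = M.actA a m ⊗ₜ (φ ^ (-g)) a' := by
  rw [inducedActA, gradedLift_of_mem 𝒜 _ ha]
  rfl

/-- The linear map sending `a`, `a'`, `m` to `m φ^g(a') ⊗ a` for `a` homogeneous of degree `g`. -/
noncomputable def inducedAux (M : TwistedModule 𝒜 φ) : A →ₗ[k] A' →ₗ[k] M →ₗ[k] M ⊗[k] A :=
  gradedLift 𝒜 fun g =>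
    LinearMap.lcomp k (M →ₗ[k] M ⊗[k] A) (M.actA' ∘ₗ (φ ^ g).toLinearMap) ∘ₗ
      LinearMap.llcomp k M M (M ⊗[k] A) ∘ₗ (TensorProduct.mk k M A).flip

/-- The action of `A'` on the module induced along `A' ⊆ A ⊗_tw A'`. -/
noncomputable def inducedActA' (M : TwistedModule 𝒜 φ) : A' →ₗ[k] Module.End k (M ⊗[k] A) :=
  TensorProduct.uncurry (RingHom.id k) M A (M ⊗[k] A) ∘ₗ
    LinearMap.lflip.toLinearMap ∘ₗ (inducedAux M).flip

lemma inducedActA'_tmul (M : TwistedModule 𝒜 φ) {g : ℤ} {a : A} (ha : a ∈ 𝒜 g) (m : M) (a' : A') :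
    inducedActA' M a' (m ⊗ₜ a) = M.actA' ((φ ^ g) a') m ⊗ₜ a := by
  change inducedAux M a a' m = _
  rw [inducedAux, gradedLift_of_mem 𝒜 _ ha]
  rfl

lemma tmul_induction_of_homogeneous {M : Type u} [AddCommGroup M] [Module k M]
    {motive : M ⊗[k] A → Prop} (zero : motive 0)
    (add : ∀ x y, motive x → motive y → motive (x + y))
    (tmul : ∀ m g, ∀ a ∈ 𝒜 g, motive (m ⊗ₜ a)) (x : M ⊗[k] A) : motive x := by
  induction x with
  | zero => exact zero
  | add x y hx hy => exact add x y hx hy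
  | tmul m a =>
    induction a using DirectSum.Decomposition.inductionOn 𝒜 with
    | zero => rwa [TensorProduct.tmul_zero]
    | add b c hb hc => rw [TensorProduct.tmul_add]; exact add _ _ hb hc
    | @homogeneous g b => exact tmul m g b b.2

variable (𝒜 φ)

/-- Induction along `A ⊆ A ⊗_tw A'` of the restriction to `A`. -/
noncomputable def inductionFromA : AugmentedFunctor 𝒜 φ A' where
  obj M :=
    { carrier := M ⊗[k] A'
      actA := inducedActA M
      actA' := LinearMap.lTensorHom M ∘ₗ (LinearMap.mul k A').flip
      actA_one := fun x => by
        induction x with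
        | zero => simp
        | add x y hx hy => rw [map_add, hx, hy]
        | tmul m a' =>
          rw [inducedActA_tmul M (SetLike.GradedOne.one_mem : (1 : A) ∈ 𝒜 0), M.actA_one]
          simp
      actA_mul := fun a b x => by
        induction x with
        | zero => simp
        | add x y hx hy => simp only [map_add, hx, hy]
        | tmul m a' =>
          induction a using DirectSum.Decomposition.inductionOn 𝒜 with
          | zero => simp
          | add a₁ a₂ h₁ h₂ => simp only [add_mul, map_add, LinearMap.add_apply, h₁, h₂]
          | @homogeneous g a =>
            induction b using DirectSum.Decomposition.inductionOn 𝒜 with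
            | zero => simp
            | add b₁ b₂ h₁ h₂ => simp only [mul_add, map_add, LinearMap.add_apply, h₁, h₂]
            | @homogeneous l b =>
              rw [inducedActA_tmul M (SetLike.mul_mem_graded a.2 b.2), inducedActA_tmul M a.2,
                inducedActA_tmul M b.2, M.actA_mul, ← AlgEquiv.mul_apply, ← zpow_add, neg_add_rev]
      actA'_one := fun x => by
        induction x with
        | zero => simp
        | add x y hx hy => rw [map_add, hx, hy]
        | tmul m a' => simp
      actA'_mul := fun a' b' x => by
        induction x with
        | zero => simp
        | add x y hx hy => simp only [map_add, hx, hy]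
        | tmul m c' => simp [mul_assoc]
      actA_actA' := fun g a ha a' x => by
        induction x with
        | zero => simp
        | add x y hx hy => simp only [map_add, hx, hy]
        | tmul m c' =>
          simp only [LinearMap.comp_apply, LinearMap.coe_lTensorHom, LinearMap.lTensor_tmul,
            LinearMap.flip_apply, LinearMap.mul_apply', inducedActA_tmul M ha, map_mul] }
  map f := LinearMap.rTensor A' f
  ε M := TensorProduct.lift M.actA'.flip
  s M := (TensorProduct.mk k M A').flip 1
  equiv M := LinearEquiv.refl k _
  map_sub f g := LinearMap.rTensor_sub f g
  map_comp f g := LinearMap.rTensor_comp A' g f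
  isHom_map {M N f} hf :=
    { map_actA := fun a (x : M ⊗[k] A') => by
        change LinearMap.rTensor A' f (inducedActA M a x) =
          inducedActA N a (LinearMap.rTensor A' f x)
        induction x with
        | zero => simp
        | add x y hx hy => simp only [map_add, hx, hy]
        | tmul m a' =>
          induction a using DirectSum.Decomposition.inductionOn 𝒜 with
          | zero => simp
          | add b c hb hc => simp only [map_add, LinearMap.add_apply, hb, hc]
          | @homogeneous g b =>
            rw [inducedActA_tmul M b.2, LinearMap.rTensor_tmul, LinearMap.rTensor_tmul,
              inducedActA_tmul N b.2, hf.map_actA]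
      map_actA' := fun a' (x : M ⊗[k] A') => by
        change LinearMap.rTensor A' f (LinearMap.lTensor M _ x) =
          LinearMap.lTensor N _ (LinearMap.rTensor A' f x)
        rw [← LinearMap.comp_apply, ← LinearMap.comp_apply, LinearMap.rTensor_comp_lTensor,
          LinearMap.lTensor_comp_rTensor] }
  isHom_ε M :=
    { map_actA := fun a (x : M ⊗[k] A') => by
        change TensorProduct.lift M.actA'.flip (inducedActA M a x) =
          M.actA a (TensorProduct.lift M.actA'.flip x)
        induction x with
        | zero => simp
        | add x y hx hy => simp only [map_add, hx, hy]
        | tmul m a' =>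
          induction a using DirectSum.Decomposition.inductionOn 𝒜 with
          | zero => simp
          | add b c hb hc => simp only [map_add, LinearMap.add_apply, hb, hc]
          | @homogeneous g b =>
            rw [inducedActA_tmul M b.2, TensorProduct.lift.tmul, TensorProduct.lift.tmul]
            exact (M.actA_actA' g b b.2 a' m).symm
      map_actA' := fun a' (x : M ⊗[k] A') => by
        change TensorProduct.lift M.actA'.flip (LinearMap.lTensor M _ x) =
          M.actA' a' (TensorProduct.lift M.actA'.flip x)
        induction x with
        | zero => simp
        | add x y hx hy => simp only [map_add, hx, hy]
        | tmul m c' => exact M.actA'_mul c' a' m }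
  ε_map {M N f} hf := fun (x : M ⊗[k] A') => by
    change TensorProduct.lift N.actA'.flip (LinearMap.rTensor A' f x) =
      f (TensorProduct.lift M.actA'.flip x)
    induction x with
    | zero => simp
    | add x y hx hy => simp only [map_add, hx, hy]
    | tmul m a' => exact (hf.map_actA' a' m).symm
  ε_s M x := M.actA'_one x
  map_s f x := rfl

/-- Induction along `A' ⊆ A ⊗_tw A'` of the restriction to `A'`. -/
noncomputable def inductionFromA' : AugmentedFunctor 𝒜 φ A where
  obj M :=
    { carrier := M ⊗[k] A
      actA := LinearMap.lTensorHom M ∘ₗ (LinearMap.mul k A).flip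
      actA' := inducedActA' M
      actA_one := fun x => by
        induction x with
        | zero => simp
        | add x y hx hy => rw [map_add, hx, hy]
        | tmul m a' => simp
      actA_mul := fun a b x => by
        induction x with
        | zero => simp
        | add x y hx hy => simp only [map_add, hx, hy]
        | tmul m c => simp [mul_assoc]
      actA'_one := fun x => by
        induction x using tmul_induction_of_homogeneous (𝒜 := 𝒜) with
        | zero => simp
        | add x y hx hy => rw [map_add, hx, hy]
        | tmul m g a ha => rw [inducedActA'_tmul M ha, map_one, M.actA'_one]
      actA'_mul := fun a' b' x => by
        induction x using tmul_induction_of_homogeneous (𝒜 := 𝒜) with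
        | zero => simp
        | add x y hx hy => simp only [map_add, hx, hy]
        | tmul m g a ha =>
          rw [inducedActA'_tmul M ha, inducedActA'_tmul M ha, inducedActA'_tmul M ha, map_mul,
            M.actA'_mul]
      actA_actA' := fun g a ha a' x => by
        induction x using tmul_induction_of_homogeneous (𝒜 := 𝒜) with
        | zero => simp
        | add x y hx hy => simp only [map_add, hx, hy]
        | tmul m l b hb =>
          rw [inducedActA'_tmul M hb]
          simp only [LinearMap.comp_apply, LinearMap.coe_lTensorHom, LinearMap.lTensor_tmul,
            LinearMap.flip_apply, LinearMap.mul_apply']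
          rw [inducedActA'_tmul M (SetLike.mul_mem_graded hb ha), ← AlgEquiv.mul_apply,
            ← zpow_add, add_neg_cancel_right] }
  map f := LinearMap.rTensor A f
  ε M := TensorProduct.lift M.actA.flip
  s M := (TensorProduct.mk k M A).flip 1
  equiv M := LinearEquiv.refl k _
  map_sub f g := LinearMap.rTensor_sub f g
  map_comp f g := LinearMap.rTensor_comp A g f
  isHom_map {M N f} hf :=
    { map_actA := fun a (x : M ⊗[k] A) => by
        change LinearMap.rTensor A f (LinearMap.lTensor M _ x) =
          LinearMap.lTensor N _ (LinearMap.rTensor A f x)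
        rw [← LinearMap.comp_apply, ← LinearMap.comp_apply, LinearMap.rTensor_comp_lTensor,
          LinearMap.lTensor_comp_rTensor]
      map_actA' := fun a' (x : M ⊗[k] A) => by
        change LinearMap.rTensor A f (inducedActA' M a' x) =
          inducedActA' N a' (LinearMap.rTensor A f x)
        induction x using tmul_induction_of_homogeneous (𝒜 := 𝒜) with
        | zero => simp
        | add x y hx hy => simp only [map_add, hx, hy]
        | tmul m g a ha =>
          rw [inducedActA'_tmul M ha, LinearMap.rTensor_tmul, LinearMap.rTensor_tmul,
            inducedActA'_tmul N ha, hf.map_actA'] }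
  isHom_ε M :=
    { map_actA := fun a (x : M ⊗[k] A) => by
        change TensorProduct.lift M.actA.flip (LinearMap.lTensor M _ x) =
          M.actA a (TensorProduct.lift M.actA.flip x)
        induction x with
        | zero => simp
        | add x y hx hy => simp only [map_add, hx, hy]
        | tmul m c => exact M.actA_mul c a m
      map_actA' := fun a' (x : M ⊗[k] A) => by
        change TensorProduct.lift M.actA.flip (inducedActA' M a' x) =
          M.actA' a' (TensorProduct.lift M.actA.flip x)
        induction x using tmul_induction_of_homogeneous (𝒜 := 𝒜) with
        | zero => simp
        | add x y hx hy => simp only [map_add, hx, hy]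
        | tmul m g a ha =>
          rw [inducedActA'_tmul M ha, TensorProduct.lift.tmul, TensorProduct.lift.tmul]
          exact M.actA_actA'_zpow g a ha a' m }
  ε_map {M N f} hf := fun (x : M ⊗[k] A) => by
    change TensorProduct.lift N.actA.flip (LinearMap.rTensor A f x) =
      f (TensorProduct.lift M.actA.flip x)
    induction x with
    | zero => simp
    | add x y hx hy => simp only [map_add, hx, hy]
    | tmul m a => exact (hf.map_actA a m).symm
  ε_s M x := M.actA_one x
  map_s f x := rfl

end Induction

/-! ### The total bar resolution -/

namespace TwistedModule

variable {𝒜 : ℤ → Submodule k A} [GradedAlgebra 𝒜] {φ : A' ≃ₐ[k] A'} (M : TwistedModule 𝒜 φ)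

/-- The doubly augmented double bar complex. -/
noncomputable def biBar (m n : ℕ) : TwistedModule 𝒜 φ :=
  (inductionFromA 𝒜 φ).iter ((inductionFromA' 𝒜 φ).iter M m) n

/-- The differential in the direction of `A'`. -/
noncomputable def biBarV (m n : ℕ) : M.biBar m (n + 1) →ₗ[k] M.biBar m n :=
  (inductionFromA 𝒜 φ).d ((inductionFromA' 𝒜 φ).iter M m) n

/-- The differential in the direction of `A`. -/
noncomputable def biBarH (m n : ℕ) : M.biBar (m + 1) n →ₗ[k] M.biBar m n :=
  (inductionFromA 𝒜 φ).mapIter ((inductionFromA' 𝒜 φ).d M m) n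

/-- The contraction in the direction of `A'`. -/
noncomputable def biBarS (m n : ℕ) : M.biBar m n →ₗ[k] M.biBar m (n + 1) :=
  (inductionFromA 𝒜 φ).contraction ((inductionFromA' 𝒜 φ).iter M m) n

lemma isHom_biBarV (m n : ℕ) : IsHom (M.biBarV m n) := AugmentedFunctor.isHom_d _ _ _

lemma isHom_biBarH (m n : ℕ) : IsHom (M.biBarH m n) :=
  AugmentedFunctor.isHom_mapIter _ (AugmentedFunctor.isHom_d _ _ _) _

lemma biBarV_biBarV (m n : ℕ) (x : M.biBar m (n + 1 + 1)) :
    M.biBarV m n (M.biBarV m (n + 1) x) = 0 :=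
  AugmentedFunctor.d_d _ _ _ x

lemma biBarH_biBarH (m n : ℕ) (x : M.biBar (m + 1 + 1) n) :
    M.biBarH m n (M.biBarH (m + 1) n x) = 0 := by
  have hcomp : (inductionFromA' 𝒜 φ).d M m ∘ₗ (inductionFromA' 𝒜 φ).d M (m + 1) = 0 :=
    LinearMap.ext (AugmentedFunctor.d_d _ M m)
  have hmap := (inductionFromA 𝒜 φ).mapIter_comp ((inductionFromA' 𝒜 φ).d M (m + 1))
    ((inductionFromA' 𝒜 φ).d M m) n
  rw [hcomp, AugmentedFunctor.mapIter_zero] at hmap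
  exact (LinearMap.congr_fun hmap x).symm

lemma biBarV_biBarH (m n : ℕ) (x : M.biBar (m + 1) (n + 1)) :
    M.biBarV m n (M.biBarH m (n + 1) x) = M.biBarH m n (M.biBarV (m + 1) n x) :=
  AugmentedFunctor.d_mapIter _ (AugmentedFunctor.isHom_d _ _ _) _ x

lemma biBarV_biBarS_zero (m : ℕ) (x : M.biBar m 0) : M.biBarV m 0 (M.biBarS m 0 x) = x :=
  AugmentedFunctor.d_zero_contraction _ _ x

lemma biBarV_biBarS_add (m n : ℕ) (x : M.biBar m (n + 1)) :
    M.biBarV m (n + 1) (M.biBarS m (n + 1) x) + M.biBarS m n (M.biBarV m n x) = x :=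
  AugmentedFunctor.d_contraction_add _ _ _ x

lemma biBarH_biBarS (m n : ℕ) (x : M.biBar (m + 1) n) :
    M.biBarH m (n + 1) (M.biBarS (m + 1) n x) = M.biBarS m n (M.biBarH m n x) :=
  AugmentedFunctor.mapIter_contraction _ _ _ x

lemma exists_biBarH_eq (m : ℕ) (x : M.biBar (m + 1) 0) (hx : M.biBarH m 0 x = 0) :
    ∃ y, M.biBarH (m + 1) 0 y = x := by
  refine ⟨(inductionFromA' 𝒜 φ).contraction M (m + 1) x, ?_⟩
  have hadd := (inductionFromA' 𝒜 φ).d_contraction_add M m x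
  have hx' : (inductionFromA' 𝒜 φ).d M m x = 0 := hx
  rw [hx', map_zero, add_zero] at hadd
  exact hadd

lemma biBarH_zero_surjective : Function.Surjective (M.biBarH 0 0) := fun x =>
  ⟨(inductionFromA' 𝒜 φ).contraction M 0 x,
    (inductionFromA' 𝒜 φ).d_zero_contraction M x⟩

/-- The underlying vector space of the double bar complex. -/
noncomputable def biBarEquiv (m n : ℕ) :
    M.biBar m n ≃ₗ[k] (M ⊗[k] TensorPower k m A) ⊗[k] TensorPower k n A' :=
  (inductionFromA 𝒜 φ).iterEquiv _ n ≪≫ₗ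
    TensorProduct.congr ((inductionFromA' 𝒜 φ).iterEquiv M m) (LinearEquiv.refl k _)

open BarDoubleComplex

/-- The total bar resolution. -/
noncomputable def totalBar (j : ℕ) : TwistedModule 𝒜 φ :=
  TwistedModule.pi fun p : Diagonal j => M.biBar (p.1.1 + 1) (p.1.2 + 1)

/-- The differential of the total bar resolution. -/
noncomputable def totalBarD (j : ℕ) : M.totalBar (j + 1) →ₗ[k] M.totalBar j :=
  totalD (E := fun m n => M.biBar m n) M.biBarV M.biBarH j

/-- The augmentation of the total bar resolution. -/
noncomputable def totalBarε : M.totalBar 0 →ₗ[k] M :=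
  totalε (E := fun m n => M.biBar m n) M.biBarV M.biBarH

lemma isHom_totalBarD (j : ℕ) : IsHom (M.totalBarD j) :=
  have hproj := isHom_proj fun q : Diagonal (j + 1) => M.biBar (q.1.1 + 1) (q.1.2 + 1)
  IsHom.pi fun p : Diagonal j =>
    ((M.isHom_biBarV (p.1.1 + 1) (p.1.2 + 1)).comp
        (hproj ⟨(p.1.1, p.1.2 + 1), by have := p.2; simp only; omega⟩)).add
      (((M.isHom_biBarH (p.1.1 + 1) (p.1.2 + 1)).comp
        (hproj ⟨(p.1.1 + 1, p.1.2), by have := p.2; simp only; omega⟩)).smul _)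

lemma isHom_totalBarε : IsHom M.totalBarε :=
  (M.isHom_biBarH 0 0).comp ((M.isHom_biBarV 1 0).comp
    (isHom_proj (fun p : Diagonal 0 => M.biBar (p.1.1 + 1) (p.1.2 + 1)) ⟨(0, 0), rfl⟩))

lemma totalBarε_surjective : Function.Surjective M.totalBarε :=
  totalε_surjective (E := fun m n => M.biBar m n) _ _ M.biBarS M.biBarV_biBarS_zero
    M.biBarH_zero_surjective

lemma range_totalBarD_zero : LinearMap.range (M.totalBarD 0) = LinearMap.ker M.totalBarε :=
  range_totalD_zero (E := fun m n => M.biBar m n) _ _ M.biBarV_biBarV M.biBarH_biBarH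
    M.biBarV_biBarH M.biBarS M.biBarV_biBarS_add M.biBarH_biBarS M.exists_biBarH_eq

lemma range_totalBarD_succ (j : ℕ) :
    LinearMap.range (M.totalBarD (j + 1)) = LinearMap.ker (M.totalBarD j) :=
  range_totalD_succ (E := fun m n => M.biBar m n) _ _ M.biBarV_biBarV M.biBarH_biBarH
    M.biBarV_biBarH M.biBarS M.biBarV_biBarS_add M.biBarH_biBarS M.exists_biBarH_eq j

/-- The diagonal is parametrized by the first coordinate. -/
def finEquivDiagonal (j : ℕ) : Fin (j + 1) ≃ Diagonal j where
  toFun i := ⟨(i.1, j - i.1), by simp only; omega⟩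
  invFun p := ⟨p.1.1, by have := p.2; omega⟩
  left_inv i := rfl
  right_inv p := by
    obtain ⟨⟨m, n⟩, rfl⟩ := p
    simp

/-- The underlying vector space of the total bar resolution. -/
noncomputable def totalBarEquiv (j : ℕ) :
    M.totalBar j ≃ₗ[k] ⨁ (i : Fin (j + 1)),
      TensorProduct k (TensorProduct k M (TensorPower k (i.1 + 1) A))
        (TensorPower k (j - i.1 + 1) A') :=
  (LinearEquiv.piCongrLeft k (fun p : Diagonal j => M.biBar (p.1.1 + 1) (p.1.2 + 1))
      (finEquivDiagonal j)).symm ≪≫ₗ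
    LinearEquiv.piCongrRight (fun i : Fin (j + 1) => M.biBarEquiv (i.1 + 1) (j - i.1 + 1)) ≪≫ₗ
    (DirectSum.linearEquivFunOnFintype k (Fin (j + 1)) _).symm

/-- The module attached to an action of the twisted tensor product. -/
def ofAct {M : Type u} [AddCommGroup M] [Module k M]
    (mul : (A ⊗[k] A') →ₗ[k] (A ⊗[k] A') →ₗ[k] (A ⊗[k] A'))
    (hmul : ∀ (a₁ : A) (a₁' a₂' : A') (g : ℤ) (a₂ : A), a₂ ∈ 𝒜 g →
      mul (a₁ ⊗ₜ[k] a₁') (a₂ ⊗ₜ[k] a₂') =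
        (a₁ * a₂) ⊗ₜ[k] ((φ ^ (-g)) a₁' * a₂'))
    (τ : M →ₗ[k] (A ⊗[k] A') →ₗ[k] M)
    (hτone : ∀ m : M, τ m ((1 : A) ⊗ₜ[k] (1 : A')) = m)
    (hτmul : ∀ (m : M) (x y : A ⊗[k] A'), τ (τ m x) y = τ m (mul x y)) :
    TwistedModule 𝒜 φ where
  carrier := M
  actA := τ.flip ∘ₗ (TensorProduct.mk k A A').flip 1
  actA' := τ.flip ∘ₗ TensorProduct.mk k A A' 1
  actA_one := hτone
  actA_mul a b m := by
    change τ m ((a * b) ⊗ₜ 1) = τ (τ m (a ⊗ₜ 1)) (b ⊗ₜ 1)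
    rw [hτmul]
    congr 1
    induction b using DirectSum.Decomposition.inductionOn 𝒜 with
    | zero => simp
    | add b c hb hc => simp only [mul_add, TensorProduct.add_tmul, map_add, hb, hc]
    | @homogeneous g b => rw [hmul _ _ _ g _ b.2, map_one, one_mul]
  actA'_one := hτone
  actA'_mul a' b' m := by
    change τ m (1 ⊗ₜ (a' * b')) = τ (τ m (1 ⊗ₜ a')) (1 ⊗ₜ b')
    rw [hτmul, hmul _ _ _ 0 _ SetLike.GradedOne.one_mem]
    simp
  actA_actA' g a ha a' m := by
    change τ (τ m (1 ⊗ₜ a')) (a ⊗ₜ 1) = τ (τ m (a ⊗ₜ 1)) (1 ⊗ₜ (φ ^ (-g)) a')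
    rw [hτmul, hτmul, hmul _ _ _ g _ ha, hmul _ _ _ 0 _ SetLike.GradedOne.one_mem]
    simp

lemma ofAct_act {M : Type u} [AddCommGroup M] [Module k M]
    (mul : (A ⊗[k] A') →ₗ[k] (A ⊗[k] A') →ₗ[k] (A ⊗[k] A'))
    (hmul : ∀ (a₁ : A) (a₁' a₂' : A') (g : ℤ) (a₂ : A), a₂ ∈ 𝒜 g →
      mul (a₁ ⊗ₜ[k] a₁') (a₂ ⊗ₜ[k] a₂') =
        (a₁ * a₂) ⊗ₜ[k] ((φ ^ (-g)) a₁' * a₂'))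
    (τ : M →ₗ[k] (A ⊗[k] A') →ₗ[k] M)
    (hτone : ∀ m : M, τ m ((1 : A) ⊗ₜ[k] (1 : A')) = m)
    (hτmul : ∀ (m : M) (x y : A ⊗[k] A'), τ (τ m x) y = τ m (mul x y)) (m : M) (x : A ⊗[k] A') :
    (ofAct mul hmul τ hτone hτmul).act m x = τ m x := by
  induction x with
  | zero => rw [map_zero, map_zero]; rfl
  | add x y hx hy => rw [map_add, map_add, hx, hy]; rfl
  | tmul a a' =>
    change τ (τ m (a ⊗ₜ 1)) (1 ⊗ₜ a') = _
    rw [hτmul, hmul _ _ _ 0 _ SetLike.GradedOne.one_mem]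
    simp

end TwistedModule

end

/-- **Lemma 3.6 of the paper.** Every unital right module `M` over the twisted
tensor product `A ⊗_tw A'` admits a bar-type resolution by right `A ⊗_tw A'`-modules: an exact
sequence `⋯ → P₂ → P₁ → P₀ → M → 0` of right `A ⊗_tw A'`-modules in which `P j` is isomorphic
as a `k`-vector space to `⊕_{m+n=j} M ⊗ A^{⊗(m+1)} ⊗ A'^{⊗(n+1)}`.  Right `A ⊗_tw A'`-module
structures are encoded as `k`-bilinear actions that are unital and associative with respect to
the twisted multiplication `mul`. -/
theorem twisted_bar_resolution_exists
    {k : Type} [Field k]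
    {A : Type} [Ring A] [Algebra k A]
    (𝒜 : ℤ → Submodule k A) [GradedAlgebra 𝒜]
    {A' : Type} [Ring A'] [Algebra k A'] (φ : A' ≃ₐ[k] A')
    (mul : (A ⊗[k] A') →ₗ[k] (A ⊗[k] A') →ₗ[k] (A ⊗[k] A'))
    (hmul : ∀ (a₁ : A) (a₁' a₂' : A') (g : ℤ) (a₂ : A), a₂ ∈ 𝒜 g →
      mul (a₁ ⊗ₜ[k] a₁') (a₂ ⊗ₜ[k] a₂') =
        (a₁ * a₂) ⊗ₜ[k] ((φ ^ (-g)) a₁' * a₂'))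
    {M : Type} [AddCommGroup M] [Module k M]
    (τ : M →ₗ[k] (A ⊗[k] A') →ₗ[k] M)
    (hτone : ∀ m : M, τ m ((1 : A) ⊗ₜ[k] (1 : A')) = m)
    (hτmul : ∀ (m : M) (x y : A ⊗[k] A'), τ (τ m x) y = τ m (mul x y)) :
    ∃ (P : ℕ → ModuleCat.{0} k)
      (act : ∀ j : ℕ, ↥(P j) →ₗ[k] (A ⊗[k] A') →ₗ[k] ↥(P j))
      (d : ∀ j : ℕ, ↥(P (j + 1)) →ₗ[k] ↥(P j))
      (ε : ↥(P 0) →ₗ[k] M),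
      -- each `P j` is a unital right `A ⊗_tw A'`-module
      (∀ j : ℕ, (∀ ξ : ↥(P j), act j ξ ((1 : A) ⊗ₜ[k] (1 : A')) = ξ) ∧
        ∀ (ξ : ↥(P j)) (x y : A ⊗[k] A'), act j (act j ξ x) y = act j ξ (mul x y)) ∧
      -- the maps of the sequence are homomorphisms of right `A ⊗_tw A'`-modules
      (∀ (ξ : ↥(P 0)) (x : A ⊗[k] A'), ε (act 0 ξ x) = τ (ε ξ) x) ∧
      (∀ (j : ℕ) (ξ : ↥(P (j + 1))) (x : A ⊗[k] A'), d j (act (j + 1) ξ x) = act j (d j ξ) x) ∧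
      -- the sequence `⋯ → P₂ → P₁ → P₀ → M → 0` is exact
      Function.Surjective ε ∧
      LinearMap.range (d 0) = LinearMap.ker ε ∧
      (∀ j : ℕ, LinearMap.range (d (j + 1)) = LinearMap.ker (d j)) ∧
      -- `P j ≅ ⊕_{m+n=j} M ⊗ A^{⊗(m+1)} ⊗ A'^{⊗(n+1)}` as `k`-vector spaces
      (∀ j : ℕ, Nonempty
        (↥(P j) ≃ₗ[k] ⨁ (i : Fin (j + 1)),
          TensorProduct k (TensorProduct k M (TensorPower k (i.1 + 1) A))
            (TensorPower k (j - i.1 + 1) A'))) := by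
  let N : TwistedModule 𝒜 φ := TwistedModule.ofAct mul hmul τ hτone hτmul
  refine ⟨fun j => ModuleCat.of k (N.totalBar j), fun j => (N.totalBar j).act, N.totalBarD,
    N.totalBarε, fun j => ⟨(N.totalBar j).act_one, (N.totalBar j).act_act mul hmul⟩,
    fun ξ x => ?_, fun j => (N.isHom_totalBarD j).map_act, N.totalBarε_surjective,
    N.range_totalBarD_zero, N.range_totalBarD_succ, fun j => ⟨N.totalBarEquiv j⟩⟩
  exact (N.isHom_totalBarε.map_act ξ x).trans
    (TwistedModule.ofAct_act mul hmul τ hτone hτmul (N.totalBarε ξ) x)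
end
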